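/- Let H be a separable Hilbert space and A a Hilbert–Schmidt operator on H such that Trace(Aⁿ) = 0 for all n ≥ 2. Then for every complex number λ with |λ| ‖A‖_{HS} < 1 (or more generally whenever the Carleman–Fredholm determinant is nonzero), I − λA is invertible; in particular I − A is invertible when Trace(Aⁿ) = 0 for all n ≥ 2 and A is Hilbert–Schmidt. -/

import Mathlib

open scoped InnerProductSpace

theorem Matrix.hasDerivAt_det {n : Type*} [Fintype n] [DecidableEq n] {M : ℂ → Matrix n n ℂ}
    {M' : Matrix n n ℂ} {z : ℂ} (h : ∀ i j, HasDerivAt (fun w => M w i j) (M' i j) z) :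
    HasDerivAt (fun w => (M w).det) (((M z).adjugate * M').trace) z := by
  have key : ((M z).adjugate * M').trace = ∑ σ : Equiv.Perm n, ((σ.sign : ℤ) : ℂ) *
      ∑ i, (∏ j ∈ Finset.univ.erase i, M z (σ j) j) • M' (σ i) i := by
    have h1 (i : n) : ((M z).adjugate * M') i i = ((M z).updateCol i (fun j => M' j i)).det := by
      rw [← Matrix.cramer_apply, Matrix.cramer_eq_adjugate_mulVec]
      rfl
    simp only [Matrix.trace, Matrix.diag_apply, h1, Matrix.det_apply', Finset.mul_sum]
    rw [Finset.sum_comm]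
    refine Finset.sum_congr rfl fun σ _ => Finset.sum_congr rfl fun i _ => ?_
    rw [← Finset.prod_erase_mul _ _ (Finset.mem_univ i), Matrix.updateCol_self, smul_eq_mul]
    congr 2
    refine Finset.prod_congr rfl fun j hj => ?_
    rw [Matrix.updateCol_ne (Finset.ne_of_mem_erase hj)]
  simp only [key, Matrix.det_apply']
  exact HasDerivAt.fun_sum fun σ _ => (HasDerivAt.fun_finsetProd fun i _ => h (σ i) i).const_mul _

/-- A holomorphic solution of `f' = g f` on a disc vanishes nowhere, unless it is zero. -/
theorem ne_zero_of_deriv_eq_mul {f g : ℂ → ℂ} {ρ : ℝ}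
    (hg : DifferentiableOn ℂ g (Metric.ball 0 ρ))
    (hf : ∀ z ∈ Metric.ball (0 : ℂ) ρ, HasDerivAt f (g z * f z) z) (h0 : f 0 ≠ 0) {z : ℂ}
    (hz : z ∈ Metric.ball (0 : ℂ) ρ) : f z ≠ 0 := by
  obtain ⟨G, hG⟩ := hg.isExactOn_ball
  have h0' : (0 : ℂ) ∈ Metric.ball (0 : ℂ) ρ := Metric.mem_ball_self (Metric.pos_of_mem_ball hz)
  have hd : ∀ w ∈ Metric.ball (0 : ℂ) ρ, HasDerivAt (fun w => f w * Complex.exp (-G w)) 0 w := by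
    intro w hw
    convert! (hf w hw).mul (hG w hw).neg.cexp using 1
    ring
  have hc := Metric.isOpen_ball.is_const_of_deriv_eq_zero (convex_ball (0 : ℂ) ρ).isPreconnected
    (fun w hw => (hd w hw).differentiableAt.differentiableWithinAt)
    (fun w hw => (hd w hw).deriv) hz h0'
  intro h
  simp [h, h0] at hc

/-- A power series with geometrically bounded coefficients is holomorphic on a disc. -/
theorem differentiableOn_tsum_pow {c : ℕ → ℂ} {C r ρ : ℝ} (hr : 0 ≤ r) (hρ : 0 ≤ ρ) (h : r * ρ < 1)
    (hc : ∀ n, ‖c n‖ ≤ C * r ^ n) :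
    DifferentiableOn ℂ (fun z => ∑' n, c n * z ^ n) (Metric.ball 0 ρ) := by
  refine Complex.differentiableOn_tsum_of_summable_norm (u := fun n => C * (r * ρ) ^ n)
    ((summable_geometric_of_lt_one (by positivity) h).mul_left C) (fun n => by fun_prop)
    Metric.isOpen_ball fun n z hz => ?_
  rw [norm_mul, norm_pow, mul_pow, ← mul_assoc]
  have : ‖z‖ ≤ ρ := (mem_ball_zero_iff.1 hz).le
  have := (norm_nonneg _).trans (hc n)
  gcongr
  exact hc n


section HilbertSchmidt

variable {H : Type*} [NormedAddCommGroup H] [InnerProductSpace ℂ H] {ι : Type*}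

theorem HilbertBasis.hasSum_sq_norm_inner (b : HilbertBasis ι ℂ H) (x : H) :
    HasSum (fun i => ‖⟪b i, x⟫_ℂ‖ ^ 2) (‖x‖ ^ 2) := by
  have h := (b.hasSum_inner_mul_inner x x).mapL Complex.reCLM
  convert h using 2 with i
  · rw [← inner_conj_symm x (b i), RCLike.conj_mul]
    norm_cast
  · rw [inner_self_eq_norm_sq_to_K]
    norm_cast

variable [CompleteSpace H]

/-- The operator norm is bounded by the Hilbert–Schmidt norm. -/
theorem ContinuousLinearMap.norm_le_sqrt_tsum (b : HilbertBasis ι ℂ H) {A : H →L[ℂ] H}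
    (hA : Summable fun i => ‖A (b i)‖ ^ 2) : ‖A‖ ≤ √(∑' i, ‖A (b i)‖ ^ 2) := by
  rw [← LinearIsometryEquiv.norm_map ContinuousLinearMap.adjoint A]
  refine ContinuousLinearMap.opNorm_le_bound _ (Real.sqrt_nonneg _) fun x => ?_
  refine le_of_sq_le_sq ?_ (by positivity)
  have h0 : 0 ≤ ∑' i, ‖A (b i)‖ ^ 2 := tsum_nonneg fun i => by positivity
  rw [mul_pow, Real.sq_sqrt h0]
  refine hasSum_le (fun i => ?_) (b.hasSum_sq_norm_inner _) (hA.hasSum.mul_right _)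
  rw [ContinuousLinearMap.adjoint_inner_right, ← mul_pow]
  gcongr
  exact norm_inner_le_norm _ _

/-- The adjoint of a Hilbert–Schmidt operator is Hilbert–Schmidt. -/
theorem ContinuousLinearMap.summable_sq_norm_adjoint (b : HilbertBasis ι ℂ H) {A : H →L[ℂ] H}
    (hA : Summable fun i => ‖A (b i)‖ ^ 2) :
    Summable fun i => ‖ContinuousLinearMap.adjoint A (b i)‖ ^ 2 := by
  have h0 (x : H) := (b.hasSum_sq_norm_inner x).tsum_eq
  have h1 : Summable fun p : ι × ι => ‖⟪b p.2, A (b p.1)⟫_ℂ‖ ^ 2 := by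
    rw [summable_prod_of_nonneg fun _ => by positivity]
    refine ⟨fun i => (b.hasSum_sq_norm_inner (A (b i))).summable, ?_⟩
    simpa only [h0] using hA
  have h2 : Summable fun p : ι × ι => ‖⟪b p.1, A (b p.2)⟫_ℂ‖ ^ 2 := h1.prod_symm
  refine ((summable_prod_of_nonneg fun _ => by positivity).1 h2).2.congr fun i => ?_
  rw [← h0]
  refine tsum_congr fun j => ?_
  rw [ContinuousLinearMap.adjoint_inner_right, norm_inner_symm]

/-- The traces of the powers of a Hilbert–Schmidt operator grow at most geometrically. -/
theorem ContinuousLinearMap.norm_trace_pow_le (b : HilbertBasis ι ℂ H) {A : H →L[ℂ] H}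
    (hA : Summable fun i => ‖A (b i)‖ ^ 2) {n : ℕ} {t : ℂ}
    (ht : HasSum (fun i => ⟪b i, (A ^ (n + 2)) (b i)⟫_ℂ) t) :
    ‖t‖ ≤ (∑' i, (‖ContinuousLinearMap.adjoint A (b i)‖ ^ 2 + ‖A (b i)‖ ^ 2)) * ‖A‖ ^ n := by
  have hs := ((summable_sq_norm_adjoint b hA).add hA).hasSum.mul_right (‖A‖ ^ n)
  rw [← ht.tsum_eq]
  refine tsum_of_norm_bounded hs fun i => ?_
  have h1 : ⟪b i, (A ^ (n + 2)) (b i)⟫_ℂ =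
      ⟪ContinuousLinearMap.adjoint A (b i), (A ^ n) (A (b i))⟫_ℂ := by
    rw [ContinuousLinearMap.adjoint_inner_left, pow_succ, pow_succ']
    rfl
  have h2 : ‖(A ^ n) (A (b i))‖ ≤ ‖A‖ ^ n * ‖A (b i)‖ := by
    have hop : ‖A ^ n‖ ≤ ‖A‖ ^ n := by
      cases n with
      | zero => exact ContinuousLinearMap.norm_id_le
      | succ n => exact norm_pow_le' A n.succ_pos
    exact (A ^ n).le_of_opNorm_le hop _
  rw [h1]
  refine (norm_inner_le_norm _ _).trans ?_
  have h3 := mul_le_mul_of_nonneg_left h2 (norm_nonneg (ContinuousLinearMap.adjoint A (b i)))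
  have h4 := mul_le_mul_of_nonneg_right
    (two_mul_le_add_sq ‖ContinuousLinearMap.adjoint A (b i)‖ ‖A (b i)‖)
    (pow_nonneg (norm_nonneg A) n)
  have h5 : 0 ≤ ‖ContinuousLinearMap.adjoint A (b i)‖ * ‖A (b i)‖ * ‖A‖ ^ n := by positivity
  linarith

end HilbertSchmidt

section Compression

variable {H : Type*} [NormedAddCommGroup H] [InnerProductSpace ℂ H] {n : Type*}

/-- The matrix of the compression of an operator to the span of a family of vectors. -/
noncomputable def compression (v : n → H) : (H →L[ℂ] H) →ₗ[ℂ] Matrix n n ℂ where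
  toFun T := Matrix.of fun i j => ⟪v i, T (v j)⟫_ℂ
  map_add' S T := by ext; simp
  map_smul' a T := by ext; simp

theorem compression_apply (v : n → H) (T : H →L[ℂ] H) (i j : n) :
    compression v T i j = ⟪v i, T (v j)⟫_ℂ := rfl

theorem Orthonormal.compression_one [DecidableEq n] {v : n → H}
    (hv : Orthonormal ℂ v) :
    compression v 1 = 1 := by
  ext i j
  simp [compression_apply, orthonormal_iff_ite.1 hv, Matrix.one_apply]

variable [Fintype n]

/-- The orthogonal projection onto the span of a finite orthonormal family. -/
noncomputable def orthonormalProj (v : n → H) : H →L[ℂ] H :=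
  ∑ i, InnerProductSpace.rankOne ℂ (v i) (v i)

theorem orthonormalProj_apply (v : n → H) (x : H) :
    orthonormalProj v x = ∑ i, ⟪v i, x⟫_ℂ • v i := by
  simp [orthonormalProj]

theorem compression_mul_compression (v : n → H) (S T : H →L[ℂ] H) :
    compression v S * compression v T = compression v (S * orthonormalProj v * T) := by
  ext i j
  simp [Matrix.mul_apply, compression_apply, orthonormalProj_apply, mul_comm]

/-- The trace of an operator of finite rank is the trace of a compression. -/
theorem hasSum_inner_mul_orthonormalProj_mul [CompleteSpace H] {ι : Type*}
    (b : HilbertBasis ι ℂ H) (v : n → H)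
    (S T : H →L[ℂ] H) :
    HasSum (fun i => ⟪b i, (S * orthonormalProj v * T) (b i)⟫_ℂ)
      (compression v (T * S)).trace := by
  have h (j : n) : HasSum (fun i => ⟪v j, T (b i)⟫_ℂ * ⟪b i, S (v j)⟫_ℂ)
      (compression v (T * S) j j) := by
    simpa [compression_apply, ContinuousLinearMap.adjoint_inner_left] using
      b.hasSum_inner_mul_inner (ContinuousLinearMap.adjoint T (v j)) (S (v j))
  refine (hasSum_sum fun j _ => h j).congr_fun fun i => ?_
  simp [orthonormalProj_apply]

variable {v : n → H}

theorem Orthonormal.inner_orthonormalProj (hv : Orthonormal ℂ v) (i : n) (x : H) :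
    ⟪v i, orthonormalProj v x⟫_ℂ = ⟪v i, x⟫_ℂ := by
  rw [orthonormalProj_apply, hv.inner_right_fintype]

theorem Orthonormal.orthonormalProj_self (hv : Orthonormal ℂ v) (i : n) :
    orthonormalProj v (v i) = v i := by
  classical
  simp [orthonormalProj_apply, orthonormal_iff_ite.1 hv]

theorem Orthonormal.compression_proj_mul (hv : Orthonormal ℂ v) (T : H →L[ℂ] H) :
    compression v (orthonormalProj v * T) = compression v T := by
  ext i j
  simp [compression_apply, hv.inner_orthonormalProj]

theorem Orthonormal.compression_mul_proj (hv : Orthonormal ℂ v) (T : H →L[ℂ] H) :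
    compression v (T * orthonormalProj v) = compression v T := by
  ext i j
  simp [compression_apply, hv.orthonormalProj_self]

open Matrix in
theorem isUnit_one_sub_mul_orthonormalProj [CompleteSpace H] [DecidableEq n] {T : H →L[ℂ] H}
    (h : (1 - compression v T).det ≠ 0) :
    IsUnit (1 - T * orthonormalProj v) := by
  have hco (x : H) (i : n) : ⟪v i, T (orthonormalProj v x)⟫_ℂ =
      (compression v T *ᵥ fun j => ⟪v j, x⟫_ℂ) i := by
    simp [orthonormalProj_apply, Matrix.mulVec, dotProduct, compression_apply,
      mul_comm]
  rw [ContinuousLinearMap.isUnit_iff_bijective]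
  constructor
  · rw [injective_iff_map_eq_zero]
    intro x hx
    have hx' : x = T (orthonormalProj v x) := sub_eq_zero.1 (by simpa using hx)
    have h0 : (fun j => ⟪v j, x⟫_ℂ) = 0 := by
      refine Matrix.eq_zero_of_mulVec_eq_zero h ?_
      rw [Matrix.sub_mulVec, Matrix.one_mulVec, sub_eq_zero]
      funext i
      rw [← hco, ← hx']
    have h1 : orthonormalProj v x = 0 := by
      rw [orthonormalProj_apply]
      exact Finset.sum_eq_zero fun i _ => by rw [show ⟪v i, x⟫_ℂ = 0 from congrFun h0 i, zero_smul]
    rw [hx', h1, map_zero]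
  · intro y
    obtain ⟨a, ha⟩ : ∃ a, (1 - compression v T) *ᵥ a = fun j => ⟪v j, y⟫_ℂ :=
      Matrix.mulVec_surjective_iff_isUnit.2 ((Matrix.isUnit_iff_isUnit_det _).2 h.isUnit) _
    have hP : orthonormalProj v (y + T (∑ i, a i • v i)) = ∑ i, a i • v i := by
      rw [orthonormalProj_apply]
      refine Finset.sum_congr rfl fun i _ => ?_
      congr 1
      have h1 : ⟪v i, T (∑ i, a i • v i)⟫_ℂ = (compression v T *ᵥ a) i := by
        simp [Matrix.mulVec, dotProduct, compression_apply, mul_comm]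
      rw [inner_add_right, ← congrFun ha i, Matrix.sub_mulVec, Matrix.one_mulVec, Pi.sub_apply, h1,
        sub_add_cancel]
    refine ⟨y + T (∑ i, a i • v i), ?_⟩
    change y + T (∑ i, a i • v i) - T (orthonormalProj v (y + T (∑ i, a i • v i))) = y
    rw [hP, add_sub_cancel_right]

end Compression

section Resolvent

variable {R : Type*} [NormedRing R] [NormedAlgebra ℂ R] [HasSummableGeomSeries R]

theorem hasDerivAt_smul_inverse_one_sub_smul {a : R} {z : ℂ} (h : IsUnit (1 - z • a)) :
    HasDerivAt (fun w : ℂ => w • Ring.inverse (1 - w • a))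
      (Ring.inverse (1 - z • a) * Ring.inverse (1 - z • a)) z := by
  obtain ⟨u, hu⟩ := h
  have h1 : HasDerivAt (fun w : ℂ => 1 - w • a) (-a) z := by
    simpa using ((hasDerivAt_id z).smul_const a).const_sub 1
  have h2 := (hu ▸ hasFDerivAt_ringInverse (𝕜 := ℂ) u :
    HasFDerivAt Ring.inverse _ (1 - z • a)).comp_hasDerivAt z h1
  have h3 := (hasDerivAt_id z).fun_smul h2
  convert! h3 using 1
  have h4 : (↑u⁻¹ : R) = ↑u⁻¹ * (1 - z • a) * ↑u⁻¹ := by rw [← hu]; simp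
  rw [← hu, Ring.inverse_unit]
  simp only [id, Function.comp, ← hu, Ring.inverse_unit, one_smul, neg_apply, map_neg, neg_neg,
    ContinuousLinearMap.mulLeftRight_apply]
  rw [mul_sub, sub_mul, mul_one, mul_smul_comm, smul_mul_assoc] at h4
  exact sub_eq_iff_eq_add'.1 h4.symm

theorem hasSum_inverse_mul_inverse [CompleteSpace R] {a b : R} {z : ℂ}
    (ha : ‖z • a‖ < 1) (hb : ‖z • b‖ < 1) :
    HasSum (fun n => z ^ n • ∑ p ∈ Finset.HasAntidiagonal.antidiagonal n, a ^ p.1 * b ^ p.2)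
      (Ring.inverse (1 - z • a) * Ring.inverse (1 - z • b)) := by
  have h {x : R} (hx : ‖x‖ < 1) : Summable fun n => ‖x ^ n‖ :=
    (summable_nat_add_iff 1).1 (Summable.of_nonneg_of_le (fun _ => norm_nonneg _)
      (fun n => norm_pow_le' x n.succ_pos)
      ((summable_nat_add_iff 1).2 (summable_geometric_of_lt_one (norm_nonneg x) hx)))
  rw [← (hasSum_geom_series_inverse _ ha).tsum_eq, ← (hasSum_geom_series_inverse _ hb).tsum_eq,
    tsum_mul_tsum_eq_tsum_sum_antidiagonal_of_summable_norm (h ha) (h hb)]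
  convert! (summable_norm_sum_mul_antidiagonal_of_summable_norm (h ha) (h hb)).of_norm.hasSum using 2
    with n
  rw [Finset.smul_sum]
  refine Finset.sum_congr rfl fun p hp => ?_
  rw [smul_pow, smul_pow, smul_mul_smul_comm, ← pow_add, Finset.HasAntidiagonal.mem_antidiagonal.1 hp]

end Resolvent

theorem pow_succ_sub_pow_succ {R : Type*} [Ring R] (a b : R) (n : ℕ) :
    a ^ (n + 1) - b ^ (n + 1) =
      ∑ p ∈ Finset.HasAntidiagonal.antidiagonal n, b ^ p.2 * (a - b) * a ^ p.1 := by
  induction n with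
  | zero => simp
  | succ n ih =>
    rw [Finset.Nat.sum_antidiagonal_succ]
    simp only [pow_zero, mul_one, pow_succ a (_ : ℕ), ← mul_assoc, ← Finset.sum_mul]
    simp only [← pow_succ, ← ih]
    noncomm_ring

section Determinant

variable {H : Type*} [NormedAddCommGroup H] [InnerProductSpace ℂ H] [CompleteSpace H]
  {n : Type*} [Fintype n] [DecidableEq n]

/-- The perturbation determinant of `1 - z A` relative to `1 - z B`. -/
noncomputable def perturbationDet (v : n → H) (A B : H →L[ℂ] H) (z : ℂ) : ℂ :=
  (1 - compression v (z • Ring.inverse (1 - z • B) * A)).det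

variable {v : n → H} {A B : H →L[ℂ] H}

theorem hasDerivAt_perturbationDet {z : ℂ} (hz : IsUnit (1 - z • B)) :
    HasDerivAt (perturbationDet v A B)
      ((1 - compression v (z • Ring.inverse (1 - z • B) * A)).adjugate *
        -compression v (Ring.inverse (1 - z • B) * Ring.inverse (1 - z • B) * A)).trace z := by
  refine Matrix.hasDerivAt_det fun i j => ?_
  let L : (H →L[ℂ] H) →L[ℂ] ℂ :=
    (innerSL ℂ (v i)).comp (ContinuousLinearMap.apply ℂ H (A (v j)))
  exact (L.hasFDerivAt.comp_hasDerivAt z (hasDerivAt_smul_inverse_one_sub_smul hz)).const_sub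
    ((1 : Matrix n n ℂ) i j)

theorem hasDerivAt_perturbationDet_of_isUnit (hv : Orthonormal ℂ v)
    (hB : B = A - A * orthonormalProj v) {z : ℂ}
    (hzA : IsUnit (1 - z • A)) (hzB : IsUnit (1 - z • B)) :
    HasDerivAt (perturbationDet v A B)
      (-(compression v (Ring.inverse (1 - z • A) * Ring.inverse (1 - z • B) * A)).trace *
        perturbationDet v A B z) z := by
  have hd := hasDerivAt_perturbationDet (v := v) (A := A) hzB
  set P := orthonormalProj v
  set R := Ring.inverse (1 - z • A)
  set Q := Ring.inverse (1 - z • B)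
  have hR : R * (1 - z • A) = 1 := Ring.inverse_mul_cancel _ hzA
  have hR' : (1 - z • A) * R = 1 := Ring.mul_inverse_cancel _ hzA
  have hQ : Q * (1 - z • B) = 1 := Ring.inverse_mul_cancel _ hzB
  have hQ' : (1 - z • B) * Q = 1 := Ring.mul_inverse_cancel _ hzB
  have hzAP : z • (A * P) = (1 - z • B) - (1 - z • A) := by rw [hB, smul_sub]; abel
  have hX : 1 + z • R * A * P = R * (1 - z • B) := by
    rw [smul_mul_assoc, smul_mul_assoc, mul_assoc, ← mul_smul_comm, hzAP, mul_sub, hR]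
    abel
  have hY : 1 - z • Q * A * P = Q * (1 - z • A) := by
    rw [smul_mul_assoc, smul_mul_assoc, mul_assoc, ← mul_smul_comm, hzAP, mul_sub, hQ]
    abel
  have key (S T : H →L[ℂ] H) : (1 + compression v S) * compression v T =
      compression v ((1 + S * P) * T) := by
    rw [← hv.compression_one, ← map_add, compression_mul_compression, add_mul, one_mul, add_mul,
      add_mul, map_add, hv.compression_proj_mul, ← map_add, one_mul]
  have hinv : (1 - compression v (z • Q * A)) * (1 + compression v (z • R * A)) = 1 := by
    have hT : 1 + compression v (z • R * A) = compression v (1 + z • R * A * P) := by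
      rw [map_add, hv.compression_one, hv.compression_mul_proj]
    rw [hT, sub_eq_add_neg, ← map_neg, key, hX, neg_mul, ← sub_eq_add_neg, hY, mul_assoc,
      ← mul_assoc _ R, hR', one_mul, hQ, hv.compression_one]
  have hadj : (1 - compression v (z • Q * A)).adjugate =
      perturbationDet v A B z • (1 + compression v (z • R * A)) := by
    have h := congrArg ((1 - compression v (z • Q * A)).adjugate * ·) hinv
    simp only [← mul_assoc, Matrix.adjugate_mul, Matrix.smul_mul, one_mul, mul_one] at h
    exact h.symm
  convert hd using 1
  rw [hadj, Matrix.mul_neg, Matrix.trace_neg, Matrix.smul_mul, key, hX, Matrix.trace_smul,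
    smul_eq_mul, mul_comm, mul_neg]
  congr 4
  rw [mul_assoc Q, ← mul_assoc (R * _), mul_assoc R _ Q, hQ', mul_one, mul_assoc]

end Determinant

section TraceZero

open Finset.HasAntidiagonal (antidiagonal)

variable {H : Type*} [NormedAddCommGroup H] [InnerProductSpace ℂ H] [CompleteSpace H]
  {ι : Type*}

/-- A Hilbert–Schmidt operator becomes small after removing finitely many columns. -/
theorem exists_finset_norm_sub_mul_orthonormalProj_le (b : HilbertBasis ι ℂ H) {A : H →L[ℂ] H}
    (hA : Summable fun i => ‖A (b i)‖ ^ 2) {ε : ℝ} (hε : 0 < ε) :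
    ∃ s : Finset ι,
      (Summable fun i => ‖(A - A * orthonormalProj fun j : s => b j) (b i)‖ ^ 2) ∧
        ‖A - A * orthonormalProj fun j : s => b j‖ ≤ ε := by
  classical
  obtain ⟨s, hs⟩ := ((tendsto_tsum_compl_atTop_zero fun i => ‖A (b i)‖ ^ 2).eventually_lt_const
    (pow_pos hε 2)).exists
  have hv : Orthonormal ℂ fun j : s => b j := b.orthonormal.comp _ Subtype.val_injective
  have hcol : (fun i => ‖(A - A * orthonormalProj fun j : s => b j) (b i)‖ ^ 2) =
      Set.indicator {i | i ∉ s} fun i => ‖A (b i)‖ ^ 2 := by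
    funext i
    by_cases hi : i ∈ s
    · have := hv.orthonormalProj_self ⟨i, hi⟩
      simp_all
    · have h0 : orthonormalProj (fun j : s => b j) (b i) = 0 := by
        rw [orthonormalProj_apply]
        refine Finset.sum_eq_zero fun j _ => ?_
        rw [b.orthonormal.2 (show (j : ι) ≠ i from fun h => hi (h ▸ j.2)), zero_smul]
      simp [hi, h0]
  have hsum : Summable fun i => ‖(A - A * orthonormalProj fun j : s => b j) (b i)‖ ^ 2 :=
    hcol ▸ hA.indicator _
  refine ⟨s, hsum, (ContinuousLinearMap.norm_le_sqrt_tsum b hsum).trans ?_⟩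
  rw [Real.sqrt_le_left hε.le, hcol, ← tsum_subtype]
  exact hs.le

theorem hasSum_inner_pow_succ_sub_pow_succ {n : Type*} [Fintype n] (b : HilbertBasis ι ℂ H)
    (v : n → H) {A B : H →L[ℂ] H} (hB : B = A - A * orthonormalProj v) (m : ℕ) :
    HasSum (fun i => ⟪b i, (A ^ (m + 1) - B ^ (m + 1)) (b i)⟫_ℂ)
      (compression v ((∑ p ∈ antidiagonal m, A ^ p.1 * B ^ p.2) * A)).trace := by
  have hAB : A - B = A * orthonormalProj v := by rw [hB]; abel
  rw [pow_succ_sub_pow_succ, hAB, Finset.sum_mul, map_sum, Matrix.trace_sum]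
  refine (hasSum_sum fun p _ => hasSum_inner_mul_orthonormalProj_mul b v (B ^ p.2 * A)
    (A ^ p.1)).congr_fun fun i => ?_
  simp [mul_assoc]

theorem isUnit_one_sub_of_trace_pow_eq_zero (b : HilbertBasis ι ℂ H) {A : H →L[ℂ] H}
    (hA : Summable fun i => ‖A (b i)‖ ^ 2)
    (htr : ∀ n : ℕ, 2 ≤ n → HasSum (fun i => ⟪b i, (A ^ n) (b i)⟫_ℂ) (0 : ℂ)) :
    IsUnit (1 - A) := by
  classical
  obtain ⟨s, hBs, hBn⟩ := exists_finset_norm_sub_mul_orthonormalProj_le b hA one_half_pos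
  set v : s → H := fun j => b j
  have hv : Orthonormal ℂ v := b.orthonormal.comp _ Subtype.val_injective
  obtain ⟨B, hB⟩ : ∃ B, B = A - A * orthonormalProj v := ⟨_, rfl⟩
  rw [← hB] at hBs hBn
  let σ (n : ℕ) : ℂ := (compression v ((∑ p ∈ antidiagonal n, A ^ p.1 * B ^ p.2) * A)).trace
  have htrB (n : ℕ) : HasSum (fun i => ⟪b i, (B ^ (n + 2)) (b i)⟫_ℂ) (-σ (n + 1)) := by
    have h := (htr (n + 2) (by lia)).sub (hasSum_inner_pow_succ_sub_pow_succ b v hB (n + 1))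
    rw [zero_sub] at h
    refine h.congr_fun fun i => ?_
    simp
  obtain ⟨C, hC⟩ : ∃ C, ∀ n, ‖-σ n‖ ≤ C * (1 / 2) ^ n := by
    set K := ∑' i, (‖ContinuousLinearMap.adjoint B (b i)‖ ^ 2 + ‖B (b i)‖ ^ 2)
    have hK : 0 ≤ K := tsum_nonneg fun i => by positivity
    refine ⟨‖σ 0‖ + 2 * K, fun n => ?_⟩
    cases n with
    | zero => rw [norm_neg, pow_zero, mul_one]; linarith
    | succ n =>
      calc ‖-σ (n + 1)‖ ≤ K * ‖B‖ ^ n := ContinuousLinearMap.norm_trace_pow_le b hBs (htrB n)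
        _ ≤ K * (1 / 2) ^ n := by gcongr
        _ = 2 * K * (1 / 2) ^ (n + 1) := by ring
        _ ≤ (‖σ 0‖ + 2 * K) * (1 / 2) ^ (n + 1) := by
          gcongr
          exact le_add_of_nonneg_left (norm_nonneg _)
  set U := Metric.ball (0 : ℂ) (3 / 2)
  have hU {z : ℂ} (hz : z ∈ U) : IsUnit (1 - z • B) := by
    refine isUnit_one_sub_of_norm_lt_one ?_
    rw [norm_smul]
    have hz' : ‖z‖ < 3 / 2 := mem_ball_zero_iff.1 hz
    nlinarith [norm_nonneg z, norm_nonneg B]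
  have hg : DifferentiableOn ℂ (fun z => ∑' n, -σ n * z ^ n) U :=
    differentiableOn_tsum_pow (by norm_num) (by norm_num) (by norm_num) hC
  set D := perturbationDet v A B
  have hD : DifferentiableOn ℂ D U := fun z hz =>
    (hasDerivAt_perturbationDet (hU hz)).differentiableAt.differentiableWithinAt
  have hlocal : deriv D =ᶠ[nhds 0] fun z => (∑' n, -σ n * z ^ n) * D z := by
    have hev (T : H →L[ℂ] H) : ∀ᶠ z : ℂ in nhds 0, ‖z • T‖ < 1 := by
      have hc : Continuous fun z : ℂ => ‖z • T‖ := by fun_prop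
      exact hc.continuousAt.eventually_lt_const (by simp)
    filter_upwards [hev A, hev B] with z hzA hzB
    rw [(hasDerivAt_perturbationDet_of_isUnit hv hB (isUnit_one_sub_of_norm_lt_one hzA)
      (isUnit_one_sub_of_norm_lt_one hzB)).deriv]
    let L : (H →L[ℂ] H) →L[ℂ] ℂ :=
      ∑ i, (innerSL ℂ (v i)).comp (ContinuousLinearMap.apply ℂ H (A (v i)))
    have hL (T : H →L[ℂ] H) : L T = (compression v (T * A)).trace := by
      simp [L, Matrix.trace, compression_apply]
    have hsum := ((hasSum_inverse_mul_inverse hzA hzB).mapL L).neg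
    rw [← hL, ← hsum.tsum_eq]
    congr 2
    funext n
    rw [map_smul, hL, smul_eq_mul, mul_comm, neg_mul]
  have hmem : (0 : ℂ) ∈ U := Metric.mem_ball_self (by norm_num)
  have heq := (hD.deriv Metric.isOpen_ball).analyticOnNhd Metric.isOpen_ball
    |>.eqOn_of_preconnected_of_eventuallyEq ((hg.mul hD).analyticOnNhd Metric.isOpen_ball)
      (convex_ball (0 : ℂ) _).isPreconnected hmem hlocal
  have hD1 : D 1 ≠ 0 := by
    refine ne_zero_of_deriv_eq_mul hg (fun z hz => ?_) ?_ (z := 1)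
      (mem_ball_zero_iff.2 (by norm_num))
    · have h := (hD.differentiableAt (Metric.isOpen_ball.mem_nhds hz)).hasDerivAt
      rwa [heq hz] at h
    · simp [D, perturbationDet]
  have h1B : IsUnit (1 - B) := by
    simpa using hU (z := 1) (mem_ball_zero_iff.2 (by norm_num))
  have hfac : 1 - A = (1 - B) * (1 - Ring.inverse (1 - B) * A * orthonormalProj v) := by
    rw [mul_sub, mul_one, ← mul_assoc, ← mul_assoc, Ring.mul_inverse_cancel _ h1B, one_mul, hB]
    abel
  rw [hfac]
  refine h1B.mul (isUnit_one_sub_mul_orthonormalProj ?_)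
  simpa [D, perturbationDet] using hD1

end TraceZero

/-- If `A` is a Hilbert–Schmidt operator on a separable Hilbert space with
`Trace(Aⁿ) = 0` for all `n ≥ 2`, then `I − λA` is invertible for every `λ` with
`|λ| ‖A‖_{HS} < 1`, and in particular `I − A` is invertible. -/
theorem stmt_10 {H : Type*} [NormedAddCommGroup H] [InnerProductSpace ℂ H]
    [CompleteSpace H] {ι : Type*} (b : HilbertBasis ι ℂ H) (A : H →L[ℂ] H)
    (hHS : Summable fun i => ‖A (b i)‖ ^ 2)
    (htr : ∀ n : ℕ, 2 ≤ n → HasSum (fun i => ⟪b i, (A ^ n) (b i)⟫_ℂ) (0 : ℂ)) :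
    (∀ lam : ℂ, ‖lam‖ * Real.sqrt (∑' i, ‖A (b i)‖ ^ 2) < 1 →
        IsUnit ((1 : H →L[ℂ] H) - lam • A)) ∧
      IsUnit ((1 : H →L[ℂ] H) - A) := by
  refine ⟨fun lam hlam => isUnit_one_sub_of_norm_lt_one ?_,
    isUnit_one_sub_of_trace_pow_eq_zero b hHS htr⟩
  rw [norm_smul]
  exact (mul_le_mul_of_nonneg_left (ContinuousLinearMap.norm_le_sqrt_tsum b hHS)
    (norm_nonneg lam)).trans_lt hlam
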